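/- arXiv:1909.10412 — 2 statements merged into one kernel-verified Lean document; each statement's English description precedes it below -/
import Mathlib

section
/- Let X be a nonempty set, n ≥ 3, and let (X,F) be an n-ary monoid, i.e., F : X^n → X is associative and E_F is nonempty. Then (E_F, F|_{E_F^n}) is a symmetric n-ary monoid: F maps E_F^n into E_F, the restriction F|_{E_F^n} is associative, invariant under all permutations of its n arguments, and possesses a neutral element. -/
variable {X : Type*}

/-- The result of substituting `F` applied to the `n` consecutive entries starting at
position `i` of the `(2n-1)`-tuple `x` (given as the first `2n-1` values of `x : ℕ → X`),
and then applying `F` to the resulting `n`-tuple. -/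
def naryCompAt (n : ℕ) (F : (Fin n → X) → X) (x : ℕ → X) (i : ℕ) : X :=
  F fun j => if (j : ℕ) < i then x j
    else if (j : ℕ) = i then F (fun k => x (i + (k : ℕ)))
    else x ((j : ℕ) + n - 1)

/-- `F` is an associative `n`-ary operation. -/
def NAryAssociative (n : ℕ) (F : (Fin n → X) → X) : Prop :=
  ∀ (x : ℕ → X) (i : ℕ), i + 1 ≤ n - 1 → naryCompAt n F x i = naryCompAt n F x (i + 1)

/-- `e` is a neutral element for the `n`-ary operation `F`: inserting the argument `a` at
any position `p`, with `e` at all the other positions, returns `a`. -/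
def NAryNeutral (n : ℕ) (F : (Fin n → X) → X) (e : X) : Prop :=
  ∀ (a : X) (p : Fin n), F (Function.update (fun _ => e) p a) = a

/-- The set `E_F` of neutral elements for `F`. -/
def naryNeutralSet (n : ℕ) (F : (Fin n → X) → X) : Set X :=
  {e | NAryNeutral n F e}

/-- `e` is a neutral element for the restriction of `F` to `S^n`. -/
def NAryNeutralOn (n : ℕ) (F : (Fin n → X) → X) (S : Set X) (e : X) : Prop :=
  e ∈ S ∧ ∀ a ∈ S, ∀ p : Fin n, F (Function.update (fun _ => e) p a) = a

/-- `iterOp G m x = G (x 0) (G (x 1) (⋯ (G (x (m-1)) (x m))⋯))`,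
the `m`-fold iterate of the binary operation `G`, applied to `m+1` arguments. -/
def iterOp (G : X → X → X) : ℕ → (ℕ → X) → X
  | 0, x => x 0
  | m + 1, x => G (x 0) (iterOp G m fun i => x (i + 1))

/-- The `n`-ary operation `F` is reducible to the binary operation `G`, i.e. `F` is the
`(n-1)`-fold iterate of `G`. -/
def NAryReducibleTo (n : ℕ) (F : (Fin n → X) → X) (G : X → X → X) : Prop :=
  ∀ x : ℕ → X, F (fun i : Fin n => x i) = iterOp G (n - 1) x

/-- `gPow G a m` is the `G`-product of `m + 1` copies of `a`. -/
def gPow (G : X → X → X) (a : X) : ℕ → X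
  | 0 => a
  | m + 1 => G a (gPow G a m)

/-- `(Y, G)` is an Abelian group whose exponent divides `m` (for `m ≥ 1`): `G` maps `Y × Y`
into `Y` and is commutative and associative on `Y`, and `Y` contains a neutral element `e`
for which every element of `Y` has an inverse and such that the `G`-product of `m` copies of
any element of `Y` equals `e`. -/
def IsAbelianGroupOfExpDvdOn (Y : Set X) (G : X → X → X) (m : ℕ) : Prop :=
  (∀ a ∈ Y, ∀ b ∈ Y, G a b ∈ Y) ∧
  (∀ a ∈ Y, ∀ b ∈ Y, G a b = G b a) ∧
  (∀ a ∈ Y, ∀ b ∈ Y, ∀ c ∈ Y, G (G a b) c = G a (G b c)) ∧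
  ∃ e ∈ Y, (∀ a ∈ Y, G e a = a) ∧ (∀ a ∈ Y, ∃ b ∈ Y, G a b = e) ∧
    (∀ a ∈ Y, gPow G a (m - 1) = e)

/-- The tuple `x` lies in `D^n_k`: at least `k` of its components are equal to each other. -/
def MemD (n k : ℕ) (x : Fin n → X) : Prop :=
  ∃ S : Finset (Fin n), k ≤ S.card ∧ ∀ i ∈ S, ∀ j ∈ S, x i = x j

/-- `F` is quasitrivial on `D^n_k`. -/
def NAryQuasitrivialOnD (n k : ℕ) (F : (Fin n → X) → X) : Prop :=
  ∀ x : Fin n → X, MemD n k x → F x ∈ Set.range x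

/-- `F` is quasitrivial on `S^n_k`, the set of tuples taking at most `k` distinct values. -/
def NAryQuasitrivialOnS (n k : ℕ) (F : (Fin n → X) → X) : Prop :=
  ∀ x : Fin n → X, (Set.range x).encard ≤ k → F x ∈ Set.range x

/-- `F` is quasitrivial. -/
def NAryQuasitrivial (n : ℕ) (F : (Fin n → X) → X) : Prop :=
  ∀ x : Fin n → X, F x ∈ Set.range x

theorem NAryAssociative.naryCompAt_eq_zero {n : ℕ} {F : (Fin n → X) → X}
    (hF : NAryAssociative n F) (x : ℕ → X) {i : ℕ} (hi : i ≤ n - 1) :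
    naryCompAt n F x 0 = naryCompAt n F x i := by
  induction i with
  | zero => rfl
  | succ i ih => rw [ih (by omega), hF x i hi]

theorem NAryNeutral.apply_eq {n : ℕ} {F : (Fin n → X) → X} {e : X} (he : NAryNeutral n F e)
    (w : Fin n → X) (p : Fin n) (hw : ∀ q, q ≠ p → w q = e) : F w = w p := by
  have : w = Function.update (fun _ => e) p (w p) := by
    ext q
    by_cases h : q = p
    · subst h; simp
    · simp [h, hw q h]
  rw [this, he]
  simp

/-- The binary operation `(a, b) ↦ F (a, b, e, …, e)`. -/
def naryMul (n : ℕ) (F : (Fin n → X) → X) (e a b : X) : X :=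
  F fun j => if (j : ℕ) = 0 then a else if (j : ℕ) = 1 then b else e

section Reduction

variable {n : ℕ} {F : (Fin n → X) → X} {e : X}

theorem naryMul_neutral_left (hn : 2 ≤ n) (he : NAryNeutral n F e) (a : X) :
    naryMul n F e e a = a := by
  rw [naryMul, he.apply_eq _ ⟨1, by omega⟩]
  · simp
  · intro q hq
    have : (q : ℕ) ≠ 1 := fun h => hq (Fin.ext h)
    simp [this]

theorem naryMul_neutral_right (hn : 2 ≤ n) (he : NAryNeutral n F e) (a : X) :
    naryMul n F e a e = a := by
  rw [naryMul, he.apply_eq _ ⟨0, by omega⟩]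
  · simp
  · intro q hq
    have : (q : ℕ) ≠ 0 := fun h => hq (Fin.ext h)
    simp [this]

/-- Padding a prefix of `x` by `e`, one more entry of `x` can be absorbed by `naryMul`. -/
theorem naryMul_prefix (hF : NAryAssociative n F) (he : NAryNeutral n F e)
    (x : ℕ → X) {k : ℕ} (hk : k + 1 < n) :
    naryMul n F e (F fun j => if (j : ℕ) ≤ k then x j else e) (x (k + 1)) =
      F fun j => if (j : ℕ) ≤ k + 1 then x j else e := by
  have h := hF.naryCompAt_eq_zero
    (fun j => if j ≤ k then x j else if j = n then x (k + 1) else e) (i := k + 1) (by omega)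
  have hblock : (F fun j => (fun j => if j ≤ k then x j else if j = n then x (k + 1) else e)
      (k + 1 + (j : ℕ))) = x (k + 1) := by
    rw [he.apply_eq _ ⟨n - (k + 1), by omega⟩]
    · have h1 : k + 1 + (n - (k + 1)) = n := by omega
      simp only [h1, if_true]
      rw [if_neg (by omega)]
    · intro q hq
      have : (q : ℕ) ≠ n - (k + 1) := fun h => hq (Fin.ext h)
      dsimp only
      rw [if_neg (by omega), if_neg (by omega)]
  unfold naryCompAt at h
  rw [hblock] at h
  convert h using 1
  · unfold naryMul
    congr 1
    ext j
    by_cases h0 : (j : ℕ) = 0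
    · simp only [h0, if_true, lt_irrefl, if_false]
      congr 1
      ext q
      have := q.2
      simp only [zero_add]
      split_ifs <;> first | rfl | omega
    · simp only [h0, if_false, not_lt_zero]
      split_ifs <;> first | rfl | omega
  · congr 1
    ext j
    have := j.2
    dsimp only
    split_ifs <;> first | rfl | omega | congr 1

theorem naryMul_eq_apply_first_last (hn : 2 ≤ n) (hF : NAryAssociative n F)
    (he : NAryNeutral n F e) (a b : X) :
    naryMul n F e a b =
      F fun j => if (j : ℕ) = 0 then a else if (j : ℕ) = n - 1 then b else e := by
  have h := (hF.naryCompAt_eq_zero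
    (fun j => if j = 0 then a else if j = n - 1 then b else e) (i := 1) (by omega)).symm.trans
    (hF.naryCompAt_eq_zero _ le_rfl)
  unfold naryCompAt at h
  have h1 : (F fun j => (fun j => if j = 0 then a else if j = n - 1 then b else e)
      (1 + (j : ℕ))) = b := by
    rw [he.apply_eq _ ⟨n - 2, by omega⟩]
    · dsimp only
      rw [if_neg (by omega), if_pos (by omega)]
    · intro q hq
      have : (q : ℕ) ≠ n - 2 := fun h => hq (Fin.ext h)
      dsimp only
      rw [if_neg (by omega), if_neg (by omega)]
  have h2 : (F fun j => (fun j => if j = 0 then a else if j = n - 1 then b else e)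
      (n - 1 + (j : ℕ))) = b := by
    rw [he.apply_eq _ ⟨0, by omega⟩]
    · dsimp only
      rw [if_neg (by omega), if_pos (by omega)]
    · intro q hq
      have : (q : ℕ) ≠ 0 := fun h => hq (Fin.ext h)
      dsimp only
      rw [if_neg (by omega), if_neg (by omega)]
  rw [h1, h2] at h
  convert h using 1
  · unfold naryMul
    congr 1
    ext j
    dsimp only
    split_ifs <;> first | rfl | omega
  · congr 1
    ext j
    have := j.2
    dsimp only
    split_ifs <;> first | rfl | omega

theorem naryMul_assoc (hn : 2 ≤ n) (hF : NAryAssociative n F) (he : NAryNeutral n F e)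
    (a b c : X) :
    naryMul n F e (naryMul n F e a b) c = naryMul n F e a (naryMul n F e b c) := by
  have h := hF.naryCompAt_eq_zero
    (fun j => if j = 0 then a else if j = 1 then b else if j = n then c else e)
    (i := 1) (by omega)
  rw [naryMul_eq_apply_first_last hn hF he b c]
  unfold naryCompAt at h
  unfold naryMul
  convert h using 1
  · congr 1
    ext j
    by_cases h0 : (j : ℕ) = 0
    · simp only [h0, if_true, lt_irrefl, if_false]
      congr 1
      ext q
      have := q.2
      simp only [zero_add]
      split_ifs <;> first | rfl | omega
    · simp only [h0, if_false, not_lt_zero]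
      split_ifs <;> first | rfl | omega
  · congr 1
    ext j
    by_cases h1 : (j : ℕ) = 1
    · simp only [h1, if_true, lt_irrefl, if_false, one_ne_zero]
      congr 1
      ext q
      have := q.2
      split_ifs <;> first | rfl | omega
    · have := j.2
      dsimp only
      split_ifs <;> first | rfl | omega

/-- An `n`-ary monoid is reducible to a binary monoid. -/
theorem exists_monoid_apply_eq_prod (hn : 2 ≤ n) (hF : NAryAssociative n F)
    (he : NAryNeutral n F e) :
    ∃ _ : Monoid X, ∀ x : Fin n → X, F x = (List.ofFn x).prod := by
  let M : Monoid X :=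
    { mul := naryMul n F e
      one := e
      mul_assoc := naryMul_assoc hn hF he
      one_mul := naryMul_neutral_left hn he
      mul_one := naryMul_neutral_right hn he }
  have key : ∀ (x : ℕ → X) (k : ℕ), k < n →
      (F fun j => if (j : ℕ) ≤ k then x j else e) =
        (List.ofFn fun j : Fin (k + 1) => x j).prod := by
    intro x k
    induction k with
    | zero =>
      intro _
      rw [he.apply_eq _ ⟨0, by omega⟩]
      · simp
      · intro q hq
        have : (q : ℕ) ≠ 0 := fun h => hq (Fin.ext h)
        rw [if_neg (by omega)]
    | succ k ih =>
      intro hk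
      rw [List.ofFn_succ', List.concat_eq_append, List.prod_append, List.prod_singleton]
      simp only [Fin.val_castSucc, Fin.val_last]
      rw [← ih (by omega)]
      exact (naryMul_prefix hF he x hk).symm
  refine ⟨M, fun x => ?_⟩
  obtain ⟨m, rfl⟩ : ∃ m, n = m + 1 := ⟨n - 1, by omega⟩
  have h := key (fun j => if hj : j < m + 1 then x ⟨j, hj⟩ else e) m (by omega)
  convert h using 2
  · ext j
    have := j.2
    rw [if_pos (by omega), dif_pos j.2]
  · simp

end Reduction

theorem prod_ofFn_update_of_mem_center {M : Type*} [Monoid M] {a : M}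
    (ha : a ∈ Submonoid.center M) (x : M) :
    ∀ (m : ℕ) (p : Fin (m + 1)),
      (List.ofFn (Function.update (fun _ => a) p x)).prod = x * a ^ m := by
  rw [Submonoid.mem_center_iff] at ha
  intro m
  induction m with
  | zero =>
    intro p
    rw [Fin.fin_one_eq_zero p]
    simp
  | succ m ih =>
    intro p
    rw [List.ofFn_succ, List.prod_cons]
    induction p using Fin.cases with
    | zero => simp [List.ofFn_const, List.prod_replicate, pow_succ']
    | succ p =>
      have : (fun i : Fin (m + 1) => Function.update (fun _ => a) p.succ x i.succ) =
          Function.update (fun _ => a) p x := by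
        ext i
        by_cases h : i = p
        · subst h; simp
        · simp [h]
      rw [this, ih, Function.update_of_ne (Fin.succ_ne_zero p).symm, ← mul_assoc, ← ha, mul_assoc,
        ← pow_succ']

/-- The submonoid of central elements whose `k`-th power is trivial. -/
def centralTorsion (M : Type*) [Monoid M] (k : ℕ) : Submonoid M where
  carrier := {a | a ∈ Submonoid.center M ∧ a ^ k = 1}
  one_mem' := ⟨one_mem _, one_pow k⟩
  mul_mem' {a b} ha hb := ⟨mul_mem ha.1 hb.1, by
    have h : Commute a b := Submonoid.mem_center_iff.1 hb.1 a
    rw [h.mul_pow, ha.2, hb.2, one_mul]⟩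

theorem nAryNeutral_iff_mem_centralTorsion [Monoid X] {n : ℕ} (hn : 3 ≤ n)
    {F : (Fin n → X) → X} (hF : ∀ x : Fin n → X, F x = (List.ofFn x).prod) (a : X) :
    NAryNeutral n F a ↔ a ∈ centralTorsion X (n - 1) := by
  obtain ⟨m, rfl⟩ : ∃ m, n = m + 3 := ⟨n - 3, by omega⟩
  constructor
  · intro h
    have h1 : a ^ (m + 2) = 1 := by
      have := h 1 0
      rw [hF, List.ofFn_succ] at this
      simpa [List.ofFn_const, List.prod_replicate, pow_succ'] using this
    refine ⟨Submonoid.mem_center_iff.2 fun x => ?_, h1⟩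
    have h2 : a * (x * a ^ (m + 1)) = x := by
      have := h x (Fin.succ 0)
      rwa [hF, List.ofFn_succ, List.ofFn_succ, List.prod_cons, List.prod_cons,
        Function.update_self, Function.update_of_ne (Fin.succ_ne_zero 0).symm,
        funext fun i : Fin (m + 1) => Function.update_of_ne
          (fun hi => Fin.succ_ne_zero i (Fin.succ_injective _ hi)) _ _,
        List.ofFn_const, List.prod_replicate] at this
    calc x * a = a * (x * a ^ (m + 1)) * a := by rw [h2]
      _ = a * x * a ^ (m + 2) := by rw [pow_succ a (m + 1)]; simp only [mul_assoc]
      _ = a * x := by rw [h1, mul_one]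
  · rintro ⟨hc, h1⟩ x p
    rw [hF, prod_ofFn_update_of_mem_center hc]
    change x * a ^ (m + 3 - 1) = x
    rw [h1, mul_one]

/-- If `(X, F)` is an `n`-ary monoid, then `(E_F, F|_{E_F^n})` is a symmetric `n`-ary monoid:
`F` maps `E_F^n` into `E_F`, the restriction is associative, invariant under all permutations
of its arguments, and has a neutral element. -/
theorem stmt_7 {X : Type*} [Nonempty X] (n : ℕ) (hn : 3 ≤ n)
    (F : (Fin n → X) → X) (hF : NAryAssociative n F)
    (hE : (naryNeutralSet n F).Nonempty) :
    (∀ e : Fin n → X, (∀ i, e i ∈ naryNeutralSet n F) → F e ∈ naryNeutralSet n F) ∧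
    (∀ x : ℕ → X, (∀ i < 2 * n - 1, x i ∈ naryNeutralSet n F) →
      ∀ i : ℕ, i + 1 ≤ n - 1 → naryCompAt n F x i = naryCompAt n F x (i + 1)) ∧
    (∀ (σ : Equiv.Perm (Fin n)) (y : Fin n → X),
      (∀ i, y i ∈ naryNeutralSet n F) → F (y ∘ σ) = F y) ∧
    (∃ e, NAryNeutralOn n F (naryNeutralSet n F) e) := by
  obtain ⟨e, he⟩ := hE
  obtain ⟨_, hprod⟩ := exists_monoid_apply_eq_prod (by omega : 2 ≤ n) hF he
  have hmem (a : X) : a ∈ naryNeutralSet n F ↔ a ∈ centralTorsion X (n - 1) :=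
    nAryNeutral_iff_mem_centralTorsion hn hprod a
  refine ⟨fun y hy => ?_, fun x _ => hF x, fun σ y hy => ?_, e, he, fun a _ => he a⟩
  · rw [hmem, hprod]
    refine Submonoid.list_prod_mem _ fun a ha => ?_
    obtain ⟨i, rfl⟩ := (List.mem_ofFn' _ _).1 ha
    exact (hmem _).1 (hy i)
  · rw [hprod, hprod]
    refine (Equiv.Perm.ofFn_comp_perm σ y).prod_eq' ?_
    refine List.pairwise_of_forall_mem_list fun a _ b hb => ?_
    obtain ⟨i, rfl⟩ := (List.mem_ofFn' _ _).1 hb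
    exact Submonoid.mem_center_iff.1 ((hmem _).1 (hy (σ i))).1 a
end

section
/- Let X be a nonempty set, n ≥ 3, let F : X^n → X be associative and quasitrivial on D^n_{n-1}, and let a, b ∈ X with a ≠ b. Then a and b are both neutral elements for F if and only if F((n-1)·a, b) = b and F(a, (n-1)·b) = a. -/
variable {X : Type*}

theorem NAryAssociative.naryCompAt_eq {n : ℕ} {F : (Fin n → X) → X} (hF : NAryAssociative n F)
    (s : ℕ → X) {i j : ℕ} (hi : i ≤ n - 1) (hj : j ≤ n - 1) :
    naryCompAt n F s i = naryCompAt n F s j := by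
  have key : ∀ i ≤ n - 1, naryCompAt n F s i = naryCompAt n F s 0 := by
    intro i
    induction i with
    | zero => exact fun _ => rfl
    | succ i ih => exact fun h => (hF s i h).symm.trans (ih (by omega))
  rw [key i hi, key j hj]

theorem naryCompAt_eq_of_forall {n : ℕ} {F : (Fin n → X) → X} {s : ℕ → X} {i : ℕ}
    (inner outer : Fin n → X) (hinner : ∀ k : Fin n, s (i + k) = inner k)
    (houter : ∀ j : Fin n, (if (j : ℕ) < i then s j else
      if (j : ℕ) = i then F inner else s (j + n - 1)) = outer j) :
    naryCompAt n F s i = F outer := by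
  simp only [naryCompAt, hinner, houter]

theorem NAryQuasitrivialOnD.apply_update {n : ℕ} {F : (Fin n → X) → X}
    (hQ : NAryQuasitrivialOnD n (n - 1) F) (a x : X) (p : Fin n) :
    F (Function.update (fun _ => a) p x) = a ∨ F (Function.update (fun _ => a) p x) = x := by
  obtain ⟨k, hk⟩ := hQ (Function.update (fun _ => a) p x) ⟨Finset.univ.erase p, by simp, by
    intro i hi j hj
    simp [Finset.ne_of_mem_erase hi, Finset.ne_of_mem_erase hj]⟩
  rw [← hk]
  by_cases h : k = p <;> simp [h]

/-- If `a` acts neutrally from both ends, then it is neutral. -/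
theorem NAryNeutral.of_ends {n : ℕ} (hn : 0 < n) {F : (Fin n → X) → X}
    (hF : NAryAssociative n F) (hQ : NAryQuasitrivialOnD n (n - 1) F) {a : X}
    (hfirst : ∀ x, F (Function.update (fun _ => a) ⟨0, hn⟩ x) = x)
    (hlast : ∀ x, F (Function.update (fun _ => a) ⟨n - 1, by omega⟩ x) = x) :
    NAryNeutral n F a := by
  intro x p
  rcases hQ.apply_update a x p with h | h
  · have hx := hF.naryCompAt_eq (fun t => if t = n - 1 then x else a)
      (Nat.sub_le (n - 1) p) (Nat.zero_le (n - 1))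
    rw [naryCompAt_eq_of_forall (Function.update (fun _ => a) p x) (fun _ => a)
        (by intro k; simp only [Function.update_apply, Fin.ext_iff]; grind)
        (by intro j; rw [h]; grind),
      naryCompAt_eq_of_forall (Function.update (fun _ => a) ⟨n - 1, by omega⟩ x)
        (Function.update (fun _ => a) ⟨0, hn⟩ x)
        (by intro k; simp only [Function.update_apply, Fin.ext_iff]; grind)
        (by intro j; rw [hlast]; simp only [Function.update_apply, Fin.ext_iff]; grind),
      hfirst] at hx
    have ha := hlast a
    rw [Function.update_eq_self_iff.2 rfl] at ha
    exact h.trans (ha.symm.trans hx)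
  · exact h

/-- For `F` associative and quasitrivial on `D^n_{n-1}` and `a ≠ b`: both `a` and `b` are
neutral for `F` iff `F ((n-1)·a, b) = b` and `F (a, (n-1)·b) = a`. -/
theorem stmt_9 {X : Type*} [Nonempty X] (n : ℕ) (hn : 3 ≤ n)
    (F : (Fin n → X) → X) (hF : NAryAssociative n F)
    (hQ : NAryQuasitrivialOnD n (n - 1) F) (a b : X) (hab : a ≠ b) :
    (NAryNeutral n F a ∧ NAryNeutral n F b) ↔
      (F (Function.update (fun _ => a) (⟨n - 1, by omega⟩ : Fin n) b) = b ∧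
        F (Function.update (fun _ => b) (⟨0, by omega⟩ : Fin n) a) = a) := by
  have h0 : 0 < n := by omega
  have hl : n - 1 < n := by omega
  refine ⟨fun h => ⟨h.1 _ _, h.2 _ _⟩, fun ⟨hb, ha⟩ => ?_⟩
  have first_eq (x : X) : F (Function.update (fun _ => a) ⟨0, h0⟩ x) =
      F (Function.update (fun _ => b) ⟨0, h0⟩ x) := by
    have h := hF.naryCompAt_eq (fun t => if t = 0 then x else if t ≤ n - 1 then a else b)
      (le_refl (n - 1)) (show 1 ≤ n - 1 by omega)
    rwa [naryCompAt_eq_of_forall (Function.update (fun _ => b) ⟨0, h0⟩ a)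
        (Function.update (fun _ => a) ⟨0, h0⟩ x)
        (by intro k; simp only [Function.update_apply, Fin.ext_iff]; grind)
        (by intro j; rw [ha]; simp only [Function.update_apply, Fin.ext_iff]; grind),
      naryCompAt_eq_of_forall (Function.update (fun _ => a) ⟨n - 1, hl⟩ b)
        (Function.update (fun _ => b) ⟨0, h0⟩ x)
        (by intro k; simp only [Function.update_apply, Fin.ext_iff]; grind)
        (by intro j; rw [hb]; simp only [Function.update_apply, Fin.ext_iff]; grind)] at h
  have last_eq (x : X) : F (Function.update (fun _ => a) ⟨n - 1, hl⟩ x) =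
      F (Function.update (fun _ => b) ⟨n - 1, hl⟩ x) := by
    have h := hF.naryCompAt_eq
      (fun t => if t < n - 1 then a else if t < 2 * (n - 1) then b else x)
      (show n - 2 ≤ n - 1 by omega) (Nat.zero_le (n - 1))
    rwa [naryCompAt_eq_of_forall (Function.update (fun _ => b) ⟨0, h0⟩ a)
        (Function.update (fun _ => a) ⟨n - 1, hl⟩ x)
        (by intro k; simp only [Function.update_apply, Fin.ext_iff]; grind)
        (by intro j; rw [ha]; simp only [Function.update_apply, Fin.ext_iff]; grind),
      naryCompAt_eq_of_forall (Function.update (fun _ => a) ⟨n - 1, hl⟩ b)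
        (Function.update (fun _ => b) ⟨n - 1, hl⟩ x)
        (by intro k; simp only [Function.update_apply, Fin.ext_iff]; grind)
        (by intro j; rw [hb]; simp only [Function.update_apply, Fin.ext_iff]; grind)] at h
  have eq_self (p : Fin n) (x : X) (h : F (Function.update (fun _ => a) p x) =
      F (Function.update (fun _ => b) p x)) :
      F (Function.update (fun _ => a) p x) = x ∧ F (Function.update (fun _ => b) p x) = x := by
    have := hQ.apply_update a x p
    have := hQ.apply_update b x p
    grind
  exact ⟨.of_ends h0 hF hQ (fun x => (eq_self _ x (first_eq x)).1)
      (fun x => (eq_self _ x (last_eq x)).1),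
    .of_ends h0 hF hQ (fun x => (eq_self _ x (first_eq x)).2)
      (fun x => (eq_self _ x (last_eq x)).2)⟩
end
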